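/- Suppose (X_A, σ_A) and (X_B, σ_B) are one-sided flow equivalent via a homeomorphism h : X_A → X_B (so in particular continuously orbit equivalent via h, with induced maps Ψ_h and Ψ_{h^{−1}}). Let f ∈ C(X_B, ℤ) and g ∈ C(X_A, ℤ) be such that [f] is an order unit of (H^B, H^B_+) and [g] is an order unit of (H^A, H^A_+). Then ζ_{A,Ψ_h(f)}(s) = ζ_{B,f}(s) and ζ_{B,Ψ_{h^{−1}}(g)}(s) = ζ_{A,g}(s), for complex s with sufficiently large real part. -/

import Mathlib

open scoped BigOperators NNReal

namespace OneSidedMarkov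

variable {N M : ℕ}

/-- The matrix has entries in `{0, 1}`. -/
def IsZeroOne (A : Matrix (Fin N) (Fin N) ℤ) : Prop := ∀ i j, A i j = 0 ∨ A i j = 1

/-- The matrix is irreducible. -/
def IsIrreducible (A : Matrix (Fin N) (Fin N) ℤ) : Prop :=
  ∀ i j, ∃ m : ℕ, 0 < m ∧ (A ^ m) i j ≠ 0

/-- The matrix is a permutation matrix. -/
def IsPermutationMatrix (A : Matrix (Fin N) (Fin N) ℤ) : Prop :=
  ∃ e : Equiv.Perm (Fin N), ∀ i j, A i j = if e i = j then 1 else 0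

/-- The one-sided topological Markov shift space `X_A`. -/
abbrev Space (A : Matrix (Fin N) (Fin N) ℤ) : Type :=
  {x : ℕ → Fin N // ∀ n, A (x n) (x (n + 1)) = 1}

/-- The shift map `σ_A`. -/
def shift (A : Matrix (Fin N) (Fin N) ℤ) (x : Space A) : Space A :=
  ⟨fun n => x.1 (n + 1), fun n => x.2 (n + 1)⟩

lemma continuous_shift (A : Matrix (Fin N) (Fin N) ℤ) : Continuous (shift A) := by
  apply Continuous.subtype_mk
  exact continuous_pi fun n => (continuous_apply (n + 1)).comp continuous_subtype_val

/-- The shift map as a continuous map. -/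
def shiftMap (A : Matrix (Fin N) (Fin N) ℤ) : C(Space A, Space A) :=
  ⟨shift A, continuous_shift A⟩

/-- The coboundary subgroup `{ g - g ∘ σ_A }` of `C(X_A, ℤ)`. -/
def cobdySubgroup (A : Matrix (Fin N) (Fin N) ℤ) : AddSubgroup C(Space A, ℤ) :=
  AddSubgroup.closure {f | ∃ g : C(Space A, ℤ), f = g - g.comp (shiftMap A)}

/-- The ordered cohomology group `H^A = C(X_A, ℤ)/{g - g∘σ_A}`. -/
abbrev Coh (A : Matrix (Fin N) (Fin N) ℤ) : Type :=
  C(Space A, ℤ) ⧸ cobdySubgroup A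

/-- The class `[f] ∈ H^A`. -/
def cohClass (A : Matrix (Fin N) (Fin N) ℤ) (f : C(Space A, ℤ)) : Coh A :=
  QuotientAddGroup.mk f

/-- The positive cone `H^A_+`. -/
def CohPos (A : Matrix (Fin N) (Fin N) ℤ) : Set (Coh A) :=
  {c | ∃ f : C(Space A, ℤ), (∀ x, 0 ≤ f x) ∧ c = cohClass A f}

/-- `u` is an order unit of `(H^A, H^A_+)`. -/
def IsOrderUnit (A : Matrix (Fin N) (Fin N) ℤ) (u : Coh A) : Prop :=
  u ∈ CohPos A ∧ ∀ g : Coh A, ∃ n : ℕ, 0 < n ∧ n • u - g ∈ CohPos A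

/-- The data `(l, k, b)` of a suspension. -/
structure SuspData (A : Matrix (Fin N) (Fin N) ℤ) where
  l : C(Space A, ℝ)
  k : C(Space A, ℝ)
  b : C(Space A, ℝ)

/-- `c = l - k`. -/
def cFun {A : Matrix (Fin N) (Fin N) ℤ} (T : SuspData A) (x : Space A) : ℝ :=
  T.l x - T.k x

/-- `(l, k, b)` is a suspension triplet for `(X_A, σ_A)`. -/
def IsSuspTriplet {A : Matrix (Fin N) (Fin N) ℤ} (T : SuspData A) : Prop :=
  (∀ x, 0 ≤ T.l x) ∧ (∀ x, 0 ≤ T.k x) ∧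
  (∃ c : C(Space A, ℤ), (∀ x, (c x : ℝ) = cFun T x) ∧ IsOrderUnit A (cohClass A c)) ∧
  (∀ x, ∃ m : ℕ, T.l x - T.b x = m) ∧
  (∀ x, ∃ m : ℕ, T.k x - T.b (shift A x) = m)

/-- The space `X_{A,b}^ℝ = {(x, r) : r ≥ b(x)}`. -/
abbrev BaseSpace {A : Matrix (Fin N) (Fin N) ℤ} (T : SuspData A) : Type :=
  {p : Space A × ℝ // T.b p.1 ≤ p.2}

/-- The elementary relation `(x, r) ∼ (σ_A(x), r - c(x))` for `r ≥ l(x)`. -/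
def SuspRel {A : Matrix (Fin N) (Fin N) ℤ} (T : SuspData A)
    (p q : BaseSpace T) : Prop :=
  T.l p.1.1 ≤ p.1.2 ∧ q.1 = (shift A p.1.1, p.1.2 - cFun T p.1.1)

/-- The equivalence relation `∼_{l,k}` generated by `SuspRel`. -/
def suspSetoid {A : Matrix (Fin N) (Fin N) ℤ} (T : SuspData A) : Setoid (BaseSpace T) :=
  ⟨Relation.EqvGen (SuspRel T), Relation.EqvGen.is_equivalence _⟩

/-- The one-sided suspension `S_{A,b}^{l,k}` with the quotient topology. -/
abbrev Susp {A : Matrix (Fin N) (Fin N) ℤ} (T : SuspData A) : Type :=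
  Quotient (suspSetoid T)

/-- The class `[x, r]`. -/
def mkSusp {A : Matrix (Fin N) (Fin N) ℤ} (T : SuspData A) (p : BaseSpace T) : Susp T :=
  Quotient.mk (suspSetoid T) p

/-- The base map `x ↦ [x, b(x)]`. -/
def basePoint {A : Matrix (Fin N) (Fin N) ℤ} (T : SuspData A) (x : Space A) : Susp T :=
  mkSusp T ⟨(x, T.b x), le_refl _⟩

/-- Translation by `t ≥ 0` on `X_{A,b}^ℝ`. -/
def shiftPt {A : Matrix (Fin N) (Fin N) ℤ} (T : SuspData A) (t : ℝ≥0)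
    (p : BaseSpace T) : BaseSpace T :=
  ⟨(p.1.1, p.1.2 + t), le_trans p.2 (le_add_of_nonneg_right t.2)⟩

lemma suspRel_shiftPt {A : Matrix (Fin N) (Fin N) ℤ} (T : SuspData A) (t : ℝ≥0)
    {p q : BaseSpace T} (h : SuspRel T p q) : SuspRel T (shiftPt T t p) (shiftPt T t q) := by
  obtain ⟨h1, h2⟩ := h
  refine ⟨le_trans h1 (le_add_of_nonneg_right t.2), ?_⟩
  show (q.1.1, q.1.2 + (t : ℝ)) = _
  rw [h2]
  show (shift A p.1.1, p.1.2 - cFun T p.1.1 + (t : ℝ))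
      = (shift A p.1.1, p.1.2 + (t : ℝ) - cFun T p.1.1)
  congr 1
  ring

lemma eqvGen_map {α : Type*} {r r' : α → α → Prop} (f : α → α)
    (hf : ∀ a b, r a b → r' (f a) (f b)) :
    ∀ a b, Relation.EqvGen r a b → Relation.EqvGen r' (f a) (f b) := by
  intro a b h
  induction h with
  | rel a b hab => exact Relation.EqvGen.rel _ _ (hf a b hab)
  | refl a => exact Relation.EqvGen.refl _
  | symm a b _ ih => exact Relation.EqvGen.symm _ _ ih
  | trans a b c _ _ ih1 ih2 => exact Relation.EqvGen.trans _ _ _ ih1 ih2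

/-- The flow `φ_{A,t}([x, r]) = [x, r + t]`, `t ∈ ℝ_+`, on the one-sided suspension. -/
def flow {A : Matrix (Fin N) (Fin N) ℤ} (T : SuspData A) (t : ℝ≥0) :
    Susp T → Susp T :=
  Quotient.map' (shiftPt T t)
    (fun p q h => eqvGen_map (shiftPt T t) (fun _ _ hr => suspRel_shiftPt T t hr) p q h)

/-- The standard suspension data `(1, 0, 0)`. -/
def stdData (A : Matrix (Fin N) (Fin N) ℤ) : SuspData A := ⟨1, 0, 0⟩

/-- The standard one-sided suspension `S_A^1`. -/
abbrev StdSusp (A : Matrix (Fin N) (Fin N) ℤ) : Type := Susp (stdData A)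

/-- The standard base map `s_A(x) = [x, 0]`. -/
def stdBase (A : Matrix (Fin N) (Fin N) ℤ) : Space A → StdSusp A :=
  basePoint (stdData A)

/-- The orbit equations of a continuous orbit equivalence. -/
def OrbitEqFns (A : Matrix (Fin N) (Fin N) ℤ) (B : Matrix (Fin M) (Fin M) ℤ)
    (h : Space A ≃ₜ Space B) (k1 l1 : C(Space A, ℕ)) (k2 l2 : C(Space B, ℕ)) : Prop :=
  (∀ x : Space A, (shift B)^[k1 x] (h (shift A x)) = (shift B)^[l1 x] (h x)) ∧
  (∀ y : Space B, (shift A)^[k2 y] (h.symm (shift B y)) = (shift A)^[l2 y] (h.symm y))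

/-- `(X_A, σ_A)` and `(X_B, σ_B)` are continuously orbit equivalent. -/
def ContOrbitEquiv (A : Matrix (Fin N) (Fin N) ℤ) (B : Matrix (Fin M) (Fin M) ℤ) : Prop :=
  ∃ h : Space A ≃ₜ Space B, ∃ k1 l1 : C(Space A, ℕ), ∃ k2 l2 : C(Space B, ℕ),
    OrbitEqFns A B h k1 l1 k2 l2

/-- One-sided flow equivalence via the homeomorphism `h`. -/
def FlowEquivVia (A : Matrix (Fin N) (Fin N) ℤ) (B : Matrix (Fin M) (Fin M) ℤ)
    (h : Space A ≃ₜ Space B) : Prop :=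
  ∃ T₁ : SuspData A, IsSuspTriplet T₁ ∧ ∃ T₂ : SuspData B, IsSuspTriplet T₂ ∧
  ∃ Φ₁ : Susp T₁ → StdSusp B, Continuous Φ₁ ∧
  ∃ Φ₂ : Susp T₂ → StdSusp A, Continuous Φ₂ ∧
  (∀ (t : ℝ≥0) (p : Susp T₁), Φ₁ (flow T₁ t p) = flow (stdData B) t (Φ₁ p)) ∧
  (∀ x : Space A, Φ₁ (basePoint T₁ x) = stdBase B (h x)) ∧
  (∀ (t : ℝ≥0) (q : Susp T₂), Φ₂ (flow T₂ t q) = flow (stdData A) t (Φ₂ q)) ∧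
  (∀ y : Space B, Φ₂ (basePoint T₂ y) = stdBase A (h.symm y))

/-- `(X_A, σ_A)` and `(X_B, σ_B)` are one-sided flow equivalent. -/
def OneSidedFlowEquiv (A : Matrix (Fin N) (Fin N) ℤ) (B : Matrix (Fin M) (Fin M) ℤ) : Prop :=
  ∃ h : Space A ≃ₜ Space B, FlowEquivVia A B h

/-- `f^m(x) = Σ_{i<m} f(σ_A^i(x))` for integer-valued `f`. -/
def birk (A : Matrix (Fin N) (Fin N) ℤ) (f : Space A → ℤ) (m : ℕ) (x : Space A) : ℤ :=
  ∑ i ∈ Finset.range m, f ((shift A)^[i] x)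

/-- `f^m(x) = Σ_{i<m} f(σ_A^i(x))` for real-valued `f`. -/
def birkR (A : Matrix (Fin N) (Fin N) ℤ) (f : Space A → ℝ) (m : ℕ) (x : Space A) : ℝ :=
  ∑ i ∈ Finset.range m, f ((shift A)^[i] x)

/-- `f^m(x) = Σ_{i<m} f(σ_A^i(x))` for ℕ-valued `f`. -/
def birkN (A : Matrix (Fin N) (Fin N) ℤ) (f : Space A → ℕ) (m : ℕ) (x : Space A) : ℕ :=
  ∑ i ∈ Finset.range m, f ((shift A)^[i] x)

/-- The map `Ψ_h` associated with a continuous orbit equivalence. -/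
def psi (A : Matrix (Fin N) (Fin N) ℤ) (B : Matrix (Fin M) (Fin M) ℤ)
    (h : Space A → Space B) (l1 k1 : Space A → ℕ) (f : Space B → ℤ) :
    Space A → ℤ :=
  fun x => (∑ i ∈ Finset.range (l1 x), f ((shift B)^[i] (h x)))
    - ∑ j ∈ Finset.range (k1 x), f ((shift B)^[j] (h (shift A x)))

/-- The dynamical zeta function `ζ_{A,f}(s)` with potential `f`. -/
noncomputable def zeta (A : Matrix (Fin N) (Fin N) ℤ) (f : Space A → ℤ) (s : ℂ) : ℂ :=
  Complex.exp (∑' n : ℕ, (1 / (n + 1 : ℂ)) *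
    ∑' x : {x : Space A // (shift A)^[n + 1] x = x},
      Complex.exp (-s * ((birk A f (n + 1) x.1 : ℤ) : ℂ)))

/-- `γ` is a periodic orbit of `(X_A, σ_A)`. -/
def IsPerOrbit (A : Matrix (Fin N) (Fin N) ℤ) (γ : Set (Space A)) : Prop :=
  ∃ (x : Space A) (p : ℕ), 0 < p ∧ (shift A)^[p] x = x ∧
    (∀ q : ℕ, 0 < q → (shift A)^[q] x = x → p ≤ q) ∧
    γ = {y | ∃ i : ℕ, i < p ∧ y = (shift A)^[i] x}

/-- `τ` is a primitive periodic orbit of the flow on the one-sided suspension. -/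
def IsFlowOrbit {A : Matrix (Fin N) (Fin N) ℤ} (T : SuspData A) (τ : Set (Susp T)) : Prop :=
  ∃ u : Susp T, (∃ t : ℝ≥0, 0 < t ∧ flow T t u = u) ∧
    τ = Set.range (fun t : ℝ≥0 => flow T t u)

/-- `ℓ(u) = min { t > 0 : φ_{A,t}(u) = u }`. -/
noncomputable def pointLen {A : Matrix (Fin N) (Fin N) ℤ} (T : SuspData A) (u : Susp T) : ℝ≥0 :=
  sInf {t : ℝ≥0 | 0 < t ∧ flow T t u = u}

/-- `ℓ(τ) = min { t > 0 : φ_{A,t}(u) = u for all u ∈ τ }`. -/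
noncomputable def orbitLen {A : Matrix (Fin N) (Fin N) ℤ} (T : SuspData A)
    (τ : Set (Susp T)) : ℝ≥0 :=
  sInf {t : ℝ≥0 | 0 < t ∧ ∀ u ∈ τ, flow T t u = u}


theorem birk_add (A : Matrix (Fin N) (Fin N) ℤ) (f : Space A → ℤ) (m n : ℕ) (x : Space A) :
    birk A f (m + n) x = birk A f m x + birk A f n ((shift A)^[m] x) :=
  birkhoffSum_add (shift A) f m n x

theorem birk_mul_of_periodic {A : Matrix (Fin N) (Fin N) ℤ} (f : Space A → ℤ) {q : ℕ}
    {y : Space A} (hy : (shift A)^[q] y = y) (k : ℕ) :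
    birk A f (k * q) y = k * birk A f q y := by
  induction k with
  | zero => simp [birk]
  | succ k ih =>
    have hk : (shift A)^[k * q] y = y :=
      (Function.IsPeriodicPt.const_mul (show Function.IsPeriodicPt (shift A) q y from hy) k)
    rw [Nat.succ_mul, birk_add, ih, hk]
    push_cast
    ring

theorem birk_of_eq_mul_minimalPeriod {A : Matrix (Fin N) (Fin N) ℤ} (f : Space A → ℤ)
    {n k : ℕ} {x : Space A} (hn : n = k * Function.minimalPeriod (shift A) x) :
    birk A f n x = k * birk A f (Function.minimalPeriod (shift A) x) x := by
  rw [hn, birk_mul_of_periodic f Function.iterate_minimalPeriod]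

/-- Tail equivalence of `u` and `v`, recording the lag `n` and the difference `s` of the
Birkhoff sums of the potential `f`. -/
def Lag (A : Matrix (Fin N) (Fin N) ℤ) (f : Space A → ℤ) (u v : Space A) (n s : ℤ) : Prop :=
  ∃ i j : ℕ, (shift A)^[i] u = (shift A)^[j] v ∧ (i : ℤ) - j = n ∧
    birk A f i u - birk A f j v = s

/-- Tail equivalence of two points. -/
def TailEq (A : Matrix (Fin N) (Fin N) ℤ) (u v : Space A) : Prop :=
  ∃ i j : ℕ, (shift A)^[i] u = (shift A)^[j] v

theorem TailEq.lag {A : Matrix (Fin N) (Fin N) ℤ} {u v : Space A} (huv : TailEq A u v)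
    (f : Space A → ℤ) : ∃ n s, Lag A f u v n s := by
  obtain ⟨i, j, hij⟩ := huv
  exact ⟨_, _, i, j, hij, rfl, rfl⟩

theorem Lag.tailEq {A : Matrix (Fin N) (Fin N) ℤ} {f : Space A → ℤ} {u v : Space A} {n s : ℤ}
    (huv : Lag A f u v n s) : TailEq A u v := by
  obtain ⟨i, j, hij, _⟩ := huv
  exact ⟨i, j, hij⟩

theorem Lag.refl (A : Matrix (Fin N) (Fin N) ℤ) (f : Space A → ℤ) (u : Space A) :
    Lag A f u u 0 0 :=
  ⟨0, 0, rfl, by simp, by simp⟩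

theorem Lag.symm {A : Matrix (Fin N) (Fin N) ℤ} {f : Space A → ℤ} {u v : Space A} {n s : ℤ}
    (huv : Lag A f u v n s) : Lag A f v u (-n) (-s) := by
  obtain ⟨i, j, hij, hn, hs⟩ := huv
  exact ⟨j, i, hij.symm, by omega, by omega⟩

theorem Lag.trans {A : Matrix (Fin N) (Fin N) ℤ} {f : Space A → ℤ} {u v w : Space A}
    {n s n' s' : ℤ} (huv : Lag A f u v n s) (hvw : Lag A f v w n' s') :
    Lag A f u w (n + n') (s + s') := by
  obtain ⟨i, j, hij, hn, hs⟩ := huv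
  obtain ⟨i', j', hij', hn', hs'⟩ := hvw
  refine ⟨i + i', j' + j, ?_, by push_cast; omega, ?_⟩
  · rw [add_comm i i', Function.iterate_add_apply, hij, ← Function.iterate_add_apply,
      add_comm i' j, Function.iterate_add_apply, hij', ← Function.iterate_add_apply, add_comm j j']
  · have h1 := birk_add A f i i' u
    have h2 := birk_add A f j' j w
    have h3 := birk_add A f j i' v
    have h4 := birk_add A f i' j v
    rw [hij] at h1
    rw [← hij'] at h2
    rw [add_comm i' j] at h4
    omega

theorem TailEq.symm {A : Matrix (Fin N) (Fin N) ℤ} {u v : Space A} (huv : TailEq A u v) :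
    TailEq A v u := by
  obtain ⟨i, j, hij⟩ := huv
  exact ⟨j, i, hij.symm⟩

theorem TailEq.trans {A : Matrix (Fin N) (Fin N) ℤ} {u v w : Space A} (huv : TailEq A u v)
    (hvw : TailEq A v w) : TailEq A u w := by
  obtain ⟨_, _, h1⟩ := huv.lag 0
  obtain ⟨_, _, h2⟩ := hvw.lag 0
  exact (h1.trans h2).tailEq

/-- The lag of a periodic point with itself is a multiple of its minimal period. -/
theorem Lag.self_of_periodic {A : Matrix (Fin N) (Fin N) ℤ} {f : Space A → ℤ} {y : Space A}
    {n s : ℤ} (hy : 0 < Function.minimalPeriod (shift A) y) (hl : Lag A f y y n s) :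
    ∃ m : ℤ, n = m * Function.minimalPeriod (shift A) y ∧
      s = m * birk A f (Function.minimalPeriod (shift A) y) y := by
  obtain ⟨i, j, hij, hn, hs⟩ := hl
  set q := Function.minimalPeriod (shift A) y with hq
  have hper : (shift A)^[q] y = y := Function.isPeriodicPt_minimalPeriod (shift A) y
  have hmod : i % q = j % q := by
    apply Function.iterate_injOn_Iio_minimalPeriod (f := shift A) (x := y)
    · exact Nat.mod_lt _ hy
    · exact Nat.mod_lt _ hy
    · simpa [Function.iterate_mod_minimalPeriod_eq, hq] using hij
  have hdecomp : ∀ i : ℕ, birk A f i y = (i / q : ℕ) * birk A f q y + birk A f (i % q) y := by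
    intro i
    have hk : (shift A)^[i / q * q] y = y :=
      (Function.IsPeriodicPt.const_mul (show Function.IsPeriodicPt (shift A) q y from hper) _)
    conv_lhs => rw [← Nat.div_add_mod' i q]
    rw [birk_add, birk_mul_of_periodic f hper, hk]
  have hi := Nat.div_add_mod' i q
  have hj := Nat.div_add_mod' j q
  refine ⟨(i / q : ℕ) - (j / q : ℕ), ?_, ?_⟩
  · rw [← hn]
    zify at hi hj hmod
    push_cast
    linear_combination (-1) * hi + hj + hmod
  · rw [← hs, hdecomp i, hdecomp j, hmod]
    ring

section Transport

variable {A : Matrix (Fin N) (Fin N) ℤ} {B : Matrix (Fin M) (Fin M) ℤ}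
  {h : Space A → Space B} {k l : Space A → ℕ}

theorem lag_iterate (H : ∀ x, (shift B)^[k x] (h (shift A x)) = (shift B)^[l x] (h x))
    (f : Space B → ℤ) (m : ℕ) (x : Space A) :
    Lag B f (h x) (h ((shift A)^[m] x)) (birk A (fun z => (l z : ℤ) - k z) m x)
      (birk A (psi A B h l k f) m x) := by
  induction m with
  | zero => simpa [birk] using Lag.refl B f (h x)
  | succ m ih =>
    have hstep : Lag B f (h ((shift A)^[m] x)) (h (shift A ((shift A)^[m] x)))
        ((l ((shift A)^[m] x) : ℤ) - k ((shift A)^[m] x))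
        (psi A B h l k f ((shift A)^[m] x)) :=
      ⟨_, _, (H _).symm, rfl, rfl⟩
    rw [Function.iterate_succ_apply', birk_add, birk_add]
    simpa [birk] using ih.trans hstep

theorem Lag.transport (H : ∀ x, (shift B)^[k x] (h (shift A x)) = (shift B)^[l x] (h x))
    {f : Space B → ℤ} {u v : Space A} {n s : ℤ} (huv : Lag A (psi A B h l k f) u v n s) :
    ∃ n', Lag B f (h u) (h v) n' s := by
  obtain ⟨i, j, hij, _, hs⟩ := huv
  have h1 := lag_iterate H f i u
  have h2 := lag_iterate H f j v
  rw [hij] at h1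
  have h3 := h1.trans h2.symm
  rw [← sub_eq_add_neg, ← sub_eq_add_neg, hs] at h3
  exact ⟨_, h3⟩

theorem TailEq.transport (H : ∀ x, (shift B)^[k x] (h (shift A x)) = (shift B)^[l x] (h x))
    {u v : Space A} (huv : TailEq A u v) : TailEq B (h u) (h v) := by
  obtain ⟨_, _, h1⟩ := huv.lag (psi A B h l k 0)
  obtain ⟨_, h2⟩ := h1.transport H
  exact h2.tailEq

theorem continuous_psi (hh : Continuous h) (hk : Continuous k) (hl : Continuous l)
    {f : Space B → ℤ} (hf : Continuous f) : Continuous (psi A B h l k f) := by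
  have hb : Continuous (fun p : ℕ × Space B => birk B f p.1 p.2) := by
    refine continuous_prod_of_discrete_left.2 fun n => ?_
    show Continuous fun y => ∑ i ∈ Finset.range n, f ((shift B)^[i] y)
    exact continuous_finsetSum _ fun i _ => hf.comp ((continuous_shift B).iterate i)
  exact (hb.comp (hl.prodMk hh)).sub (hb.comp (hk.prodMk (hh.comp (continuous_shift A))))

end Transport

section Perfect

variable {A : Matrix (Fin N) (Fin N) ℤ}

/-- Membership in a neighbourhood of `x` is forced by finitely many coordinates. -/
theorem exists_cylinder_subset {x : Space A} {U : Set (Space A)} (hU : U ∈ nhds x) :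
    ∃ n : ℕ, ∀ z : Space A, (∀ i < n, z.1 i = x.1 i) → z ∈ U := by
  rw [nhds_subtype_eq_comap, Filter.mem_comap] at hU
  obtain ⟨V, hV, hVU⟩ := hU
  rw [nhds_pi, Filter.mem_pi] at hV
  obtain ⟨I, hI, t, ht, htV⟩ := hV
  obtain ⟨n, hn⟩ := hI.bddAbove
  refine ⟨n + 1, fun z hz => hVU (htV fun i hi => ?_)⟩
  rw [hz i (Nat.lt_succ_of_le (hn hi))]
  exact mem_of_mem_nhds (ht i)

theorem cylinder_mem_nhds (x : Space A) (n : ℕ) :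
    {z : Space A | ∀ i < n, z.1 i = x.1 i} ∈ nhds x := by
  have h1 : ∀ i ∈ Finset.range n, ∀ᶠ z : Space A in nhds x, z.1 i = x.1 i := by
    intro i _
    have hc : Continuous fun z : Space A => z.1 i :=
      (continuous_apply i).comp continuous_subtype_val
    exact hc.continuousAt.eventually (isOpen_discrete {x.1 i} |>.mem_nhds rfl)
  have h2 := (Filter.eventually_all_finset (Finset.range n)).2 h1
  filter_upwards [h2] with z hz i hi using hz i (Finset.mem_range.2 hi)

/-- The first `n` coordinates of `x` followed by `z`. -/
def splice (x : Space A) (n : ℕ) (z : Space A) (hz : z.1 0 = x.1 n) : Space A :=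
  ⟨fun i => if i < n then x.1 i else z.1 (i - n), fun i => by
    rcases lt_trichotomy (i + 1) n with hi | hi | hi
    · simpa [hi, Nat.lt_of_succ_lt hi] using x.2 i
    · subst hi
      simpa [hz] using x.2 i
    · have h1 : ¬ i < n := by omega
      have h2 : ¬ i + 1 < n := by omega
      have h3 : i + 1 - n = i - n + 1 := by omega
      simpa [h1, h2, h3] using z.2 (i - n)⟩

theorem shift_iterate_apply (x : Space A) (n i : ℕ) : ((shift A)^[n] x).1 i = x.1 (i + n) := by
  induction n generalizing x with
  | zero => rfl
  | succ n ih =>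
    rw [Function.iterate_succ_apply, ih]
    show x.1 (i + n + 1) = _
    rw [add_assoc]

theorem shift_iterate_splice (x : Space A) (n : ℕ) (z : Space A) (hz : z.1 0 = x.1 n) :
    (shift A)^[n] (splice x n z hz) = z := by
  apply Subtype.ext
  funext i
  rw [shift_iterate_apply]
  simp [splice]

theorem splice_apply_of_lt (x : Space A) (n : ℕ) (z : Space A) (hz : z.1 0 = x.1 n) {i : ℕ}
    (hi : i < n) : (splice x n z hz).1 i = x.1 i := by
  simp [splice, hi]

theorem exists_successor (h01 : IsZeroOne A) (hirr : IsIrreducible A) (i : Fin N) :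
    ∃ j, A i j = 1 := by
  obtain ⟨m, hm, hne⟩ := hirr i i
  obtain ⟨m, rfl⟩ := Nat.exists_eq_succ_of_ne_zero hm.ne'
  rw [pow_succ', Matrix.mul_apply] at hne
  obtain ⟨j, _, hj⟩ := Finset.exists_ne_zero_of_sum_ne_zero hne
  exact ⟨j, (h01 i j).resolve_left (left_ne_zero_of_mul hj)⟩

theorem exists_predecessor (h01 : IsZeroOne A) (hirr : IsIrreducible A) (j : Fin N) :
    ∃ i, A i j = 1 := by
  obtain ⟨m, hm, hne⟩ := hirr j j
  obtain ⟨m, rfl⟩ := Nat.exists_eq_succ_of_ne_zero hm.ne'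
  rw [pow_succ, Matrix.mul_apply] at hne
  obtain ⟨i, _, hi⟩ := Finset.exists_ne_zero_of_sum_ne_zero hne
  exact ⟨i, (h01 i j).resolve_left (right_ne_zero_of_mul hi)⟩

/-- Some vertex has two successors. -/
theorem exists_branching (h01 : IsZeroOne A) (hirr : IsIrreducible A)
    (hnp : ¬ IsPermutationMatrix A) : ∃ v j j', A v j = 1 ∧ A v j' = 1 ∧ j ≠ j' := by
  by_contra! hcon
  choose e he using exists_successor h01 hirr
  have hsurj : Function.Surjective e := by
    intro j
    obtain ⟨i, hi⟩ := exists_predecessor h01 hirr j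
    exact ⟨i, hcon i _ _ (he i) hi⟩
  refine hnp ⟨Equiv.ofBijective e hsurj.bijective_of_finite, fun i j => ?_⟩
  rw [Equiv.ofBijective_apply]
  split_ifs with hij
  · rw [← hij, he]
  · exact (h01 i j).resolve_right fun h1 => hij (hcon i _ _ (he i) h1)

theorem exists_point_from (h01 : IsZeroOne A) (hirr : IsIrreducible A) (i : Fin N) :
    ∃ z : Space A, z.1 0 = i := by
  choose e he using exists_successor h01 hirr
  refine ⟨⟨fun n => e^[n] i, fun n => ?_⟩, rfl⟩
  show A (e^[n] i) (e^[n + 1] i) = 1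
  rw [Function.iterate_succ_apply']
  exact he _

theorem exists_cons (i : Fin N) (z : Space A) (hz : A i (z.1 0) = 1) :
    ∃ w : Space A, w.1 0 = i ∧ shift A w = z :=
  ⟨⟨fun n => Nat.casesOn n i z.1, fun n => by cases n with
    | zero => exact hz
    | succ n => exact z.2 n⟩, rfl, rfl⟩

theorem exists_two_points_from (h01 : IsZeroOne A) (hirr : IsIrreducible A)
    (hnp : ¬ IsPermutationMatrix A) (i : Fin N) :
    ∃ z z' : Space A, z ≠ z' ∧ z.1 0 = i ∧ z'.1 0 = i := by
  obtain ⟨v, j, j', hj, hj', hne⟩ := exists_branching h01 hirr hnp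
  obtain ⟨m, _, hm⟩ := hirr i v
  clear * - hm hj hj' hne h01 hirr
  induction m generalizing i with
  | zero =>
    have hiv : i = v := by
      by_contra hiv
      exact hm (by simp [hiv])
    subst hiv
    obtain ⟨z, hz⟩ := exists_point_from h01 hirr j
    obtain ⟨z', hz'⟩ := exists_point_from h01 hirr j'
    obtain ⟨w, hw, hwz⟩ := exists_cons i z (by rw [hz, hj])
    obtain ⟨w', hw', hwz'⟩ := exists_cons i z' (by rw [hz', hj'])
    refine ⟨w, w', ?_, hw, hw'⟩
    rintro rfl
    exact hne (by rw [← hz, ← hz', ← hwz, ← hwz'])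
  | succ m ih =>
    rw [pow_succ', Matrix.mul_apply] at hm
    obtain ⟨t, _, ht⟩ := Finset.exists_ne_zero_of_sum_ne_zero hm
    have hit := (h01 i t).resolve_left (left_ne_zero_of_mul ht)
    obtain ⟨z, z', hzz, hz, hz'⟩ := ih t (right_ne_zero_of_mul ht)
    obtain ⟨w, hw, hwz⟩ := exists_cons i z (by rw [hz, hit])
    obtain ⟨w', hw', hwz'⟩ := exists_cons i z' (by rw [hz', hit])
    refine ⟨w, w', ?_, hw, hw'⟩
    rintro rfl
    exact hzz (by rw [← hwz', ← hwz])

/-- The shift space of an irreducible non-permutation matrix has no isolated points. -/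
theorem nhdsNE_neBot (h01 : IsZeroOne A) (hirr : IsIrreducible A)
    (hnp : ¬ IsPermutationMatrix A) (x : Space A) : (nhdsWithin x {x}ᶜ).NeBot := by
  rw [← mem_closure_iff_nhdsWithin_neBot, mem_closure_iff_nhds]
  intro U hU
  obtain ⟨n, hn⟩ := exists_cylinder_subset hU
  obtain ⟨z, z', hne, hz, hz'⟩ := exists_two_points_from h01 hirr hnp (x.1 n)
  have hmem : ∀ (z : Space A) (hz : z.1 0 = x.1 n), splice x n z hz ∈ U :=
    fun z hz => hn _ fun i hi => splice_apply_of_lt x n z hz hi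
  by_cases hx : splice x n z hz = x
  · refine ⟨_, hmem z' hz', fun hx' => hne ?_⟩
    rw [← shift_iterate_splice x n z hz, ← shift_iterate_splice x n z' hz', hx,
      Set.mem_singleton_iff.1 hx']
  · exact ⟨_, hmem z hz, hx⟩

theorem finite_setOf_iterate_eq_iterate {i j : ℕ} (hij : i < j) :
    {x : Space A | (shift A)^[i] x = (shift A)^[j] x}.Finite := by
  refine Set.Finite.of_injOn (t := (Set.univ : Set (Fin j → Fin N)))
    (f := fun (x : Space A) (t : Fin j) => x.1 t) (fun _ _ => Set.mem_univ _) ?_ Set.finite_univ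
  intro x hx y hy hxy
  apply Subtype.ext
  funext n
  induction n using Nat.strong_induction_on with
  | _ n ih =>
    by_cases hn : n < j
    · exact congrFun hxy ⟨n, hn⟩
    · have hx' := congrFun (congrArg Subtype.val hx) (n - j)
      have hy' := congrFun (congrArg Subtype.val hy) (n - j)
      rw [shift_iterate_apply, shift_iterate_apply, Nat.sub_add_cancel (not_lt.1 hn)] at hx' hy'
      rw [← hx', ← hy']
      exact ih _ (by omega)

theorem finite_setOf_iterate_eq (n : ℕ) (y : Space A) :
    {x : Space A | (shift A)^[n] x = y}.Finite := by
  refine Set.Finite.of_injOn (t := (Set.univ : Set (Fin n → Fin N)))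
    (f := fun (x : Space A) (t : Fin n) => x.1 t) (fun _ _ => Set.mem_univ _) ?_ Set.finite_univ
  intro x hx z hz hxz
  apply Subtype.ext
  funext i
  by_cases hi : i < n
  · exact congrFun hxz ⟨i, hi⟩
  · have h1 := congrFun (congrArg Subtype.val (hx.trans hz.symm)) (i - n)
    rwa [shift_iterate_apply, shift_iterate_apply, Nat.sub_add_cancel (not_lt.1 hi)] at h1

theorem isClosed_path : IsClosed {x : ℕ → Fin N | ∀ n, A (x n) (x (n + 1)) = 1} := by
  simp only [Set.ofPred_forall]
  refine isClosed_iInter fun n => ?_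
  have hc : Continuous fun x : ℕ → Fin N => (x n, x (n + 1)) :=
    (continuous_apply n).prodMk (continuous_apply (n + 1))
  exact (isClosed_discrete {p : Fin N × Fin N | A p.1 p.2 = 1}).preimage hc

/-- The points that are not eventually periodic are dense. -/
theorem dense_aperiodic (h01 : IsZeroOne A) (hirr : IsIrreducible A)
    (hnp : ¬ IsPermutationMatrix A) :
    Dense {x : Space A | ∀ i j, (shift A)^[i] x = (shift A)^[j] x → i = j} := by
  have : CompactSpace (Space A) := isCompact_iff_compactSpace.1 isClosed_path.isCompact
  have : ∀ x : Space A, (nhdsWithin x {x}ᶜ).NeBot := nhdsNE_neBot h01 hirr hnp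
  have hd : Dense (⋂ p : {p : ℕ × ℕ // p.1 < p.2},
      {x : Space A | (shift A)^[p.1.1] x = (shift A)^[p.1.2] x}ᶜ) := by
    refine dense_iInter_of_isOpen (fun p => ?_) (fun p => ?_)
    · exact (finite_setOf_iterate_eq_iterate p.2).isClosed.isOpen_compl
    · rw [Set.compl_eq_univ_sdiff]
      exact dense_univ.sdiff_finite (finite_setOf_iterate_eq_iterate p.2)
  refine hd.mono fun x hx i j hij => ?_
  simp only [Set.mem_iInter, Set.mem_compl_iff, Set.mem_ofPred_eq, Subtype.forall,
    Prod.forall] at hx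
  rcases lt_trichotomy i j with hlt | heq | hlt
  · exact absurd hij (hx i j hlt)
  · exact heq
  · exact absurd hij.symm (hx j i hlt)

end Perfect

theorem birk_one (A : Matrix (Fin N) (Fin N) ℤ) (n : ℕ) (x : Space A) :
    birk A (fun _ => 1) n x = n := by
  simp [birk]

/-- A lag coming from eventual periodicity produces a periodic point in the tail. -/
theorem Lag.exists_periodic {A : Matrix (Fin N) (Fin N) ℤ} {f : Space A → ℤ} {u : Space A}
    {n s : ℤ} (hl : Lag A f u u n s) (hs : s ≠ 0) :
    ∃ y, 0 < Function.minimalPeriod (shift A) y ∧ TailEq A u y := by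
  have key : ∀ i j : ℕ, i < j → (shift A)^[i] u = (shift A)^[j] u →
      ∃ y, 0 < Function.minimalPeriod (shift A) y ∧ TailEq A u y := by
    intro i j hij h
    refine ⟨(shift A)^[i] u, ?_, i, 0, rfl⟩
    refine Function.IsPeriodicPt.minimalPeriod_pos (n := j - i) (by omega) ?_
    show (shift A)^[j - i] ((shift A)^[i] u) = _
    rw [← Function.iterate_add_apply, Nat.sub_add_cancel hij.le, h]
  obtain ⟨i, j, hij, _, hs'⟩ := hl
  rcases lt_trichotomy i j with hlt | rfl | hlt
  · exact key i j hlt hij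
  · exact absurd (by rw [← hs', sub_self]) hs
  · exact key j i hlt hij.symm

/-- The data of a continuous orbit equivalence, from `A` to `B`. -/
structure OrbitData (A : Matrix (Fin N) (Fin N) ℤ) (B : Matrix (Fin M) (Fin M) ℤ)
    (h : Space A ≃ₜ Space B) (k1 l1 : C(Space A, ℕ)) (k2 l2 : C(Space B, ℕ)) : Prop where
  fwd : ∀ x, (shift B)^[k1 x] (h (shift A x)) = (shift B)^[l1 x] (h x)
  bwd : ∀ y, (shift A)^[k2 y] (h.symm (shift B y)) = (shift A)^[l2 y] (h.symm y)
  denseA : Dense {x : Space A | ∀ i j, (shift A)^[i] x = (shift A)^[j] x → i = j}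
  denseB : Dense {x : Space B | ∀ i j, (shift B)^[i] x = (shift B)^[j] x → i = j}
  neBotA : ∀ x : Space A, (nhdsWithin x {x}ᶜ).NeBot
  neBotB : ∀ x : Space B, (nhdsWithin x {x}ᶜ).NeBot

namespace OrbitData

variable {A : Matrix (Fin N) (Fin N) ℤ} {B : Matrix (Fin M) (Fin M) ℤ}
  {h : Space A ≃ₜ Space B} {k1 l1 : C(Space A, ℕ)} {k2 l2 : C(Space B, ℕ)}

theorem symm (D : OrbitData A B h k1 l1 k2 l2) : OrbitData B A h.symm k2 l2 k1 l1 :=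
  ⟨D.bwd, D.fwd, D.denseB, D.denseA, D.neBotB, D.neBotA⟩

theorem tailEq_iff (D : OrbitData A B h k1 l1 k2 l2) {x : Space A} {y : Space B} :
    TailEq B (h x) y ↔ TailEq A (h.symm y) x := by
  constructor
  · intro hxy
    simpa using (hxy.transport D.bwd).symm
  · intro hxy
    simpa using (hxy.transport D.fwd).symm

theorem psi_const_one (h : Space A → Space B) (l k : Space A → ℕ) :
    psi A B h l k (fun _ => 1) = fun x => (l x : ℤ) - k x := by
  funext x
  simp [psi]

/-- The cocycle of the inverse pulls back to the constant function `1`. -/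
theorem psi_cocycle (D : OrbitData A B h k1 l1 k2 l2) :
    psi A B h l1 k1 (fun y => (l2 y : ℤ) - k2 y) = fun _ => 1 := by
  have hc : Continuous fun y => (l2 y : ℤ) - k2 y :=
    (continuous_of_discreteTopology.comp l2.continuous).sub
      (continuous_of_discreteTopology.comp k2.continuous)
  refine Continuous.ext_on D.denseA
    (continuous_psi h.continuous k1.continuous l1.continuous hc) continuous_const ?_
  intro x hx
  have hstep : Lag B (fun y => (l2 y : ℤ) - k2 y) (h x) (h (shift A x)) _
      (psi A B h l1 k1 (fun y => (l2 y : ℤ) - k2 y) x) :=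
    ⟨_, _, (D.fwd x).symm, rfl, rfl⟩
  rw [← psi_const_one h.symm l2 k2] at hstep
  obtain ⟨n', i, j, hij, _, hs⟩ := hstep.transport D.bwd
  rw [birk_one, birk_one, h.symm_apply_apply, h.symm_apply_apply,
    ← Function.iterate_succ_apply] at *
  have := hx i (j + 1) hij
  rw [← psi_const_one h.symm l2 k2]
  show _ = (1 : ℤ)
  omega

/-- The lag of the orbit equivalence is locally constant along a finite orbit segment. -/
theorem exists_eventually_lag (D : OrbitData A B h k1 l1 k2 l2) (p : ℕ) (x : Space A) :
    ∃ i j : ℕ, (i : ℤ) - j = birk A (fun z => (l1 z : ℤ) - k1 z) p x ∧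
      ∀ᶠ z in nhds x, (shift B)^[i] (h z) = (shift B)^[j] (h ((shift A)^[p] z)) := by
  induction p with
  | zero => exact ⟨0, 0, by simp [birk], by simp⟩
  | succ p ih =>
    obtain ⟨i, j, hij, hev⟩ := ih
    set w := (shift A)^[p] x with hw
    have hcont : ContinuousAt (fun z => (shift A)^[p] z) x :=
      ((continuous_shift A).iterate p).continuousAt
    have hl : ∀ᶠ z in nhds w, l1 z = l1 w :=
      l1.continuous.continuousAt.eventually (isOpen_discrete {l1 w} |>.mem_nhds rfl)
    have hk : ∀ᶠ z in nhds w, k1 z = k1 w :=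
      k1.continuous.continuousAt.eventually (isOpen_discrete {k1 w} |>.mem_nhds rfl)
    refine ⟨i + l1 w, k1 w + j, ?_, ?_⟩
    · rw [birk_add, ← hij]
      simp [birk, ← hw]
      ring
    · filter_upwards [hev, hcont.eventually hl, hcont.eventually hk] with z h1 h2 h3
      have h4 := D.fwd ((shift A)^[p] z)
      rw [h2, h3] at h4
      rw [add_comm i, Function.iterate_add_apply, h1, ← Function.iterate_add_apply,
        add_comm (l1 w), Function.iterate_add_apply, ← h4, ← Function.iterate_add_apply,
        Function.iterate_succ_apply', add_comm j]

/-- The cocycle is nonnegative over periodic points. -/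
theorem birk_cocycle_nonneg (D : OrbitData A B h k1 l1 k2 l2) {p : ℕ} (hp : 0 < p)
    {x : Space A} (hx : (shift A)^[p] x = x) :
    0 ≤ birk A (fun z => (l1 z : ℤ) - k1 z) p x := by
  by_contra! hneg
  obtain ⟨L, K, hLK, hev⟩ := D.exists_eventually_lag p x
  have hlt : L < K := by omega
  obtain ⟨d, rfl⟩ := Nat.exists_eq_add_of_lt hlt
  set y := (shift B)^[L] (h x) with hy
  have hcont : ContinuousAt (fun z => (shift B)^[L] (h z)) x :=
    (((continuous_shift B).iterate L).comp h.continuous).continuousAt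
  have hev' := hcont.eventually (cylinder_mem_nhds y (d + 1))
  obtain ⟨n, hn⟩ := exists_cylinder_subset (hev.and hev')
  have hU := cylinder_mem_nhds x (n + 1)
  set U := {z : Space A | ∀ i < n + 1, z.1 i = x.1 i} with hUdef
  have hUprop : ∀ z ∈ U, (shift B)^[L] (h z) = (shift B)^[L + d + 1] (h ((shift A)^[p] z)) ∧
      ∀ i < d + 1, ((shift B)^[L] (h z)).1 i = y.1 i :=
    fun z hz => hn z fun i hi => hz i (by omega)
  have hpre : ∀ z ∈ U, ∃ z' ∈ U,
      (shift B)^[L] (h z') = (shift B)^[d + 1] ((shift B)^[L] (h z)) := by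
    intro z hz
    have hxper : ∀ i, x.1 (i + p) = x.1 i := fun i => by
      rw [← shift_iterate_apply, hx]
    have hz0 : z.1 0 = x.1 p := by
      rw [hz 0 (by omega), ← hxper 0, zero_add]
    have hmem : splice x p z hz0 ∈ U := by
      intro i hi
      by_cases hip : i < p
      · exact splice_apply_of_lt x p z hz0 hip
      · obtain ⟨i, rfl⟩ := Nat.exists_eq_add_of_le' (not_lt.1 hip)
        rw [← shift_iterate_apply, shift_iterate_splice, hxper]
        exact hz i (by omega)
    refine ⟨_, hmem, ?_⟩
    rw [(hUprop _ hmem).1, shift_iterate_splice, ← Function.iterate_add_apply,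
      show L + d + 1 = d + 1 + L by omega]
  have hiter : ∀ m : ℕ, ∀ z ∈ U, ∀ i < d + 1,
      ((shift B)^[L] (h z)).1 (i + m * (d + 1)) = y.1 i := by
    intro m
    induction m with
    | zero => intro z hz i hi; simpa using (hUprop z hz).2 i hi
    | succ m ih =>
      intro z hz i hi
      obtain ⟨z', hz', hzz'⟩ := hpre z hz
      have := ih z' hz' i hi
      rw [hzz', shift_iterate_apply] at this
      rw [Nat.succ_mul, ← add_assoc]
      exact this
  have hconst : ∀ z ∈ U, (shift B)^[L] (h z) = y := by
    intro z hz
    apply Subtype.ext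
    funext i
    have hi := Nat.mod_lt i (Nat.succ_pos d)
    have h1 := hiter (i / (d + 1)) z hz _ hi
    have h2 := hiter (i / (d + 1)) x (fun _ _ => rfl) _ hi
    rw [Nat.succ_eq_add_one, Nat.mod_add_div'] at h1 h2
    rw [h1, ← h2]
  have := D.neBotA x
  refine infinite_of_mem_nhds x hU (Set.Finite.of_injOn (f := h) (fun z hz => hconst z hz)
    h.injective.injOn (finite_setOf_iterate_eq L y))

/-- The tail of the image of a periodic point contains a periodic point. -/
theorem exists_periodic (D : OrbitData A B h k1 l1 k2 l2) {x : Space A}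
    (hx : 0 < Function.minimalPeriod (shift A) x) :
    ∃ y, 0 < Function.minimalPeriod (shift B) y ∧ TailEq B (h x) y := by
  have hl := lag_iterate D.fwd (fun y => (l2 y : ℤ) - k2 y)
    (Function.minimalPeriod (shift A) x) x
  rw [Function.iterate_minimalPeriod, D.psi_cocycle, birk_one] at hl
  exact hl.exists_periodic (by omega)

/-- Birkhoff sums of `Ψ_h(f)` and `f` over corresponding periodic orbits agree. -/
theorem birk_psi_minimalPeriod (D : OrbitData A B h k1 l1 k2 l2) (f : Space B → ℤ)
    {x : Space A} {y : Space B} (hx : 0 < Function.minimalPeriod (shift A) x)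
    (hy : 0 < Function.minimalPeriod (shift B) y) (hxy : TailEq B (h x) y) :
    birk A (psi A B h l1 k1 f) (Function.minimalPeriod (shift A) x) x =
      birk B f (Function.minimalPeriod (shift B) y) y := by
  set p := Function.minimalPeriod (shift A) x with hp
  set q := Function.minimalPeriod (shift B) y with hq
  have hxp : (shift A)^[p] x = x := Function.iterate_minimalPeriod
  have hyq : (shift B)^[q] y = y := Function.iterate_minimalPeriod
  have key : ∀ f : Space B → ℤ, ∃ m : ℤ,
      birk A (fun z => (l1 z : ℤ) - k1 z) p x = m * q ∧
      birk A (psi A B h l1 k1 f) p x = m * birk B f q y := by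
    intro f
    have hl := lag_iterate D.fwd f p x
    rw [hxp] at hl
    obtain ⟨a, b, hab⟩ := hxy.lag f
    have h1 := (hab.symm.trans hl).trans hab
    rw [neg_add_cancel_comm, neg_add_cancel_comm] at h1
    exact h1.self_of_periodic hy
  obtain ⟨m, hm1, hm2⟩ := key fun y => (l2 y : ℤ) - k2 y
  rw [D.psi_cocycle, birk_one] at hm2
  obtain ⟨m', hm'⟩ : ∃ m' : ℤ, birk B (fun y => (l2 y : ℤ) - k2 y) q y = m' * p := by
    have hl := lag_iterate D.bwd 0 q y
    rw [hyq] at hl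
    obtain ⟨a, b, hab⟩ := (D.tailEq_iff.1 hxy).lag 0
    have h1 := (hab.symm.trans hl).trans hab
    rw [neg_add_cancel_comm, neg_add_cancel_comm] at h1
    obtain ⟨m', h2, _⟩ := h1.self_of_periodic hx
    exact ⟨m', h2⟩
  have hp0 : (0 : ℤ) < p := by exact_mod_cast hx
  have hq0 : (0 : ℤ) < q := by exact_mod_cast hy
  have hmm : m * m' = 1 := by
    rw [hm'] at hm2
    apply mul_right_cancel₀ hp0.ne'
    linarith
  have hnn := D.birk_cocycle_nonneg hx hxp
  rw [hm1] at hnn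
  have hm0 : 0 ≤ m := nonneg_of_mul_nonneg_left hnn hq0
  have hm : m = 1 := Int.eq_one_or_neg_one_of_mul_eq_one hmm |>.resolve_right (by omega)
  obtain ⟨r, hr1, hr2⟩ := key f
  have hr : r = m := mul_right_cancel₀ hq0.ne' (by rw [← hr1, hm1])
  rw [hr2, hr, hm, one_mul]

end OrbitData

/-- Sums over two index sets related by a correspondence with finite fibres agree when the
summands, divided by the fibre cardinalities, agree on related pairs. -/
theorem hasSum_of_correspondence {α β : Type*} (R : α → β → Prop) (F : α → ℂ) (G : β → ℂ)
    (hα : ∀ a, Nat.card {b // R a b} ≠ 0) (hβ : ∀ b, Nat.card {a // R a b} ≠ 0)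
    (hFG : ∀ a b, R a b → F a / Nat.card {b // R a b} = G b / Nat.card {a // R a b})
    (hG : Summable G) : HasSum F (∑' b, G b) := by
  have hfα : ∀ a, Finite {b // R a b} := fun a => Nat.finite_of_card_ne_zero (hα a)
  have hfβ : ∀ b, Finite {a // R a b} := fun b => Nat.finite_of_card_ne_zero (hβ b)
  let _ : ∀ a, Fintype {b // R a b} := fun a => Fintype.ofFinite _
  let _ : ∀ b, Fintype {a // R a b} := fun b => Fintype.ofFinite _
  let w : (Σ b, {a // R a b}) → ℂ := fun p => G p.1 / Nat.card {a // R a p.1}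
  have hinner : ∀ b, HasSum (fun a : {a // R a b} => w ⟨b, a⟩) (G b) := by
    intro b
    have hb : (Nat.card {a // R a b} : ℂ) ≠ 0 := by exact_mod_cast hβ b
    convert hasSum_fintype (fun a : {a // R a b} => w ⟨b, a⟩) using 1
    simp only [w, Finset.sum_const, Finset.card_univ, ← Nat.card_eq_fintype_card, nsmul_eq_mul]
    field_simp
  have hw : Summable w := by
    rw [← summable_norm_iff, summable_sigma_of_nonneg fun _ => norm_nonneg _]
    refine ⟨fun b => (hasSum_fintype _).summable, ?_⟩
    convert hG.norm using 2 with b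
    have hb : (Nat.card {a // R a b} : ℝ) ≠ 0 := by exact_mod_cast hβ b
    simp only [w, tsum_fintype, Finset.sum_const, Finset.card_univ, ← Nat.card_eq_fintype_card,
      nsmul_eq_mul, norm_div, Complex.norm_natCast]
    field_simp
  have hS : HasSum w (∑' b, G b) := by
    rw [(hw.hasSum.sigma hinner).tsum_eq]
    exact hw.hasSum
  let e : (Σ a, {b // R a b}) ≃ (Σ b, {a // R a b}) :=
    { toFun := fun p => ⟨p.2.1, p.1, p.2.2⟩
      invFun := fun p => ⟨p.2.1, p.1, p.2.2⟩
      left_inv := fun _ => rfl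
      right_inv := fun _ => rfl }
  refine (e.hasSum_iff.2 hS).sigma fun a => ?_
  have ha : (Nat.card {b // R a b} : ℂ) ≠ 0 := by exact_mod_cast hα a
  convert hasSum_fintype (fun b : {b // R a b} => (w ∘ e) ⟨a, b⟩) using 1
  have hwe : ∀ b : {b // R a b}, (w ∘ e) ⟨a, b⟩ = F a / Nat.card {b // R a b} :=
    fun b => (hFG a b.1 b.2).symm
  simp only [hwe, Finset.sum_const, Finset.card_univ, ← Nat.card_eq_fintype_card, nsmul_eq_mul]
  field_simp

/-- The periodic points in the tail class of a periodic point form its orbit. -/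
theorem card_periodic_tail {A : Matrix (Fin N) (Fin N) ℤ} {u x : Space A}
    (hx : 0 < Function.minimalPeriod (shift A) x) (hux : TailEq A u x) :
    Nat.card {z // 0 < Function.minimalPeriod (shift A) z ∧ TailEq A u z} =
      Function.minimalPeriod (shift A) x := by
  set p := Function.minimalPeriod (shift A) x with hp
  have hper : x ∈ Function.periodicPts (shift A) :=
    Function.minimalPeriod_pos_iff_mem_periodicPts.1 hx
  let φ : Fin p → {z // 0 < Function.minimalPeriod (shift A) z ∧ TailEq A u z} := fun i =>
    ⟨(shift A)^[i] x, by rwa [Function.minimalPeriod_apply_iterate hper],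
      hux.trans ⟨i, 0, rfl⟩⟩
  have hφ : Function.Bijective φ := by
    constructor
    · intro i j hij
      exact Fin.ext (Function.iterate_injOn_Iio_minimalPeriod (f := shift A) (x := x)
        (Set.mem_Iio.2 i.2) (Set.mem_Iio.2 j.2) (congrArg Subtype.val hij))
    · rintro ⟨z, hz, huz⟩
      obtain ⟨i, j, hij⟩ := hux.symm.trans huz
      set r := Function.minimalPeriod (shift A) z with hr
      have hzr : (shift A)^[j * r] z = z :=
        (Function.isPeriodicPt_minimalPeriod (shift A) z).const_mul j
      have hle : j ≤ j * r := Nat.le_mul_of_pos_right j hz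
      refine ⟨⟨(j * r - j + i) % p, Nat.mod_lt _ hx⟩, Subtype.ext ?_⟩
      show (shift A)^[(j * r - j + i) % p] x = z
      rw [hp, Function.iterate_mod_minimalPeriod_eq, Function.iterate_add_apply, hij,
        ← Function.iterate_add_apply, Nat.sub_add_cancel hle, hzr]
  rw [← Nat.card_eq_of_bijective φ hφ, Nat.card_eq_fintype_card, Fintype.card_fin]

/-- Points fixed by a positive iterate of the shift, together with the exponent. -/
abbrev PerPt (A : Matrix (Fin N) (Fin N) ℤ) : Type :=
  Σ n : ℕ, {x : Space A // (shift A)^[n + 1] x = x}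

/-- The summand of the logarithm of the zeta function. -/
noncomputable def zetaTerm (A : Matrix (Fin N) (Fin N) ℤ) (f : Space A → ℤ) (s : ℂ)
    (a : PerPt A) : ℂ :=
  (1 / (a.1 + 1 : ℂ)) * Complex.exp (-s * ((birk A f (a.1 + 1) a.2.1 : ℤ) : ℂ))

theorem zeta_eq_exp_tsum {A : Matrix (Fin N) (Fin N) ℤ} {f : Space A → ℤ} {s : ℂ}
    (hs : Summable (zetaTerm A f s)) : zeta A f s = Complex.exp (∑' a, zetaTerm A f s a) := by
  rw [hs.tsum_sigma, zeta]
  simp only [zetaTerm, tsum_mul_left]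

theorem PerPt.minimalPeriod_pos {A : Matrix (Fin N) (Fin N) ℤ} (a : PerPt A) :
    0 < Function.minimalPeriod (shift A) a.2.1 :=
  Function.IsPeriodicPt.minimalPeriod_pos (Nat.succ_pos a.1) a.2.2

theorem PerPt.exists_eq_mul {A : Matrix (Fin N) (Fin N) ℤ} (a : PerPt A) :
    ∃ k, a.1 + 1 = k * Function.minimalPeriod (shift A) a.2.1 :=
  exists_eq_mul_left_of_dvd (Function.IsPeriodicPt.minimalPeriod_dvd a.2.2)

/-- Two periodic points correspond if their orbits do and are run through equally often. -/
def PerPt.Corr {A : Matrix (Fin N) (Fin N) ℤ} {B : Matrix (Fin M) (Fin M) ℤ}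
    (h : Space A → Space B) (a : PerPt A) (b : PerPt B) : Prop :=
  TailEq B (h a.2.1) b.2.1 ∧
    (a.1 + 1) * Function.minimalPeriod (shift B) b.2.1 =
      (b.1 + 1) * Function.minimalPeriod (shift A) a.2.1

theorem card_corr {A : Matrix (Fin N) (Fin N) ℤ} {B : Matrix (Fin M) (Fin M) ℤ}
    {h : Space A → Space B} (a : PerPt A) {y : Space B}
    (hy : 0 < Function.minimalPeriod (shift B) y) (hay : TailEq B (h a.2.1) y) :
    Nat.card {b // PerPt.Corr h a b} = Function.minimalPeriod (shift B) y := by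
  rw [← card_periodic_tail hy hay]
  refine Nat.card_eq_of_bijective
    (fun b => ⟨b.1.2.1, b.1.minimalPeriod_pos, b.2.1⟩) ⟨?_, ?_⟩
  · rintro ⟨⟨m, z, hz⟩, hb⟩ ⟨⟨m', z', hz'⟩, hb'⟩ heq
    obtain rfl : z = z' := congrArg Subtype.val heq
    have h1 : m + 1 = m' + 1 :=
      Nat.eq_of_mul_eq_mul_right a.minimalPeriod_pos (hb.2.symm.trans hb'.2)
    obtain rfl : m = m' := Nat.succ_injective h1
    rfl
  · rintro ⟨z, hz, haz⟩
    obtain ⟨k, hk⟩ := a.exists_eq_mul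
    have hk0 : 0 < k := Nat.pos_of_ne_zero (by rintro rfl; simp at hk)
    have hm : k * Function.minimalPeriod (shift B) z - 1 + 1 =
        k * Function.minimalPeriod (shift B) z :=
      Nat.sub_add_cancel (Nat.mul_pos hk0 hz)
    have hfix : (shift B)^[k * Function.minimalPeriod (shift B) z - 1 + 1] z = z := by
      rw [hm]
      exact (Function.isPeriodicPt_minimalPeriod (shift B) z).const_mul k
    refine ⟨⟨⟨_, z, hfix⟩, haz, ?_⟩, rfl⟩
    show (a.1 + 1) * Function.minimalPeriod (shift B) z =
      (k * Function.minimalPeriod (shift B) z - 1 + 1) * Function.minimalPeriod (shift A) a.2.1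
    rw [Nat.sub_add_cancel (Nat.mul_pos hk0 hz), mul_right_comm, ← hk]

theorem OrbitData.corr_iff {A : Matrix (Fin N) (Fin N) ℤ} {B : Matrix (Fin M) (Fin M) ℤ}
    {h : Space A ≃ₜ Space B} {k1 l1 : C(Space A, ℕ)} {k2 l2 : C(Space B, ℕ)}
    (D : OrbitData A B h k1 l1 k2 l2) (a : PerPt A) (b : PerPt B) :
    PerPt.Corr h a b ↔ PerPt.Corr h.symm b a :=
  and_congr D.tailEq_iff eq_comm

theorem OrbitData.zeta_psi {A : Matrix (Fin N) (Fin N) ℤ} {B : Matrix (Fin M) (Fin M) ℤ}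
    {h : Space A ≃ₜ Space B} {k1 l1 : C(Space A, ℕ)} {k2 l2 : C(Space B, ℕ)}
    (D : OrbitData A B h k1 l1 k2 l2) (f : Space B → ℤ) {s : ℂ}
    (hs : Summable (zetaTerm B f s)) :
    zeta A (psi A B h l1 k1 f) s = zeta B f s := by
  have hcard : ∀ b : PerPt B, Nat.card {a // PerPt.Corr h a b} =
      Nat.card {a // PerPt.Corr h.symm b a} := fun b =>
    Nat.card_congr (Equiv.subtypeEquivRight fun a => D.corr_iff a b)
  have hsum : HasSum (zetaTerm A (psi A B h l1 k1 f) s) (∑' b, zetaTerm B f s b) := by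
    refine hasSum_of_correspondence (PerPt.Corr h) _ _ (fun a => ?_) (fun b => ?_)
      (fun a b hab => ?_) hs
    · obtain ⟨y, hy, hay⟩ := D.exists_periodic a.minimalPeriod_pos
      rw [card_corr a hy hay]
      exact hy.ne'
    · obtain ⟨x, hx, hbx⟩ := D.symm.exists_periodic b.minimalPeriod_pos
      rw [hcard, card_corr b hx hbx]
      exact hx.ne'
    · have hp := a.minimalPeriod_pos
      have hq := b.minimalPeriod_pos
      rw [hcard, card_corr a hq hab.1, card_corr b hp (D.tailEq_iff.1 hab.1)]
      obtain ⟨k, hk⟩ := a.exists_eq_mul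
      obtain ⟨k', hk'⟩ := b.exists_eq_mul
      have hpq := hab.2
      have hkk : k = k' := by
        refine Nat.eq_of_mul_eq_mul_right (Nat.mul_pos hp hq) ?_
        rw [← mul_assoc, ← hk, hpq, mul_comm (Function.minimalPeriod (shift A) _), ← mul_assoc,
          ← hk']
      have hbirk : birk A (psi A B h l1 k1 f) (a.1 + 1) a.2.1 = birk B f (b.1 + 1) b.2.1 := by
        rw [birk_of_eq_mul_minimalPeriod _ hk, birk_of_eq_mul_minimalPeriod _ hk', hkk,
          D.birk_psi_minimalPeriod f hp hq hab.1]
      rw [zetaTerm, zetaTerm, hbirk, div_mul_eq_mul_div, div_mul_eq_mul_div, div_div, div_div]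
      congr 1
      exact_mod_cast hpq
  rw [zeta_eq_exp_tsum hsum.summable, zeta_eq_exp_tsum hs, hsum.tsum_eq]

/-- Coboundaries have vanishing Birkhoff sums over periodic points. -/
theorem birk_eq_zero_of_mem_cobdySubgroup {A : Matrix (Fin N) (Fin N) ℤ} {φ : C(Space A, ℤ)}
    (hφ : φ ∈ cobdySubgroup A) {m : ℕ} {x : Space A} (hx : (shift A)^[m] x = x) :
    birk A φ m x = 0 := by
  induction hφ using AddSubgroup.closure_induction with
  | mem φ hφ =>
    obtain ⟨g, rfl⟩ := hφ
    have h1 : birk A (⇑(g - g.comp (shiftMap A))) m x =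
        ∑ i ∈ Finset.range m, (g ((shift A)^[i] x) - g ((shift A)^[i + 1] x)) := by
      refine Finset.sum_congr rfl fun i _ => ?_
      rw [Function.iterate_succ_apply']
      rfl
    rw [h1, Finset.sum_range_sub', hx]
    simp
  | zero => simp [birk]
  | add φ ψ _ _ h1 h2 =>
    have h3 : birk A (⇑(φ + ψ)) m x = birk A φ m x + birk A ψ m x := Finset.sum_add_distrib
    rw [h3, h1, h2, add_zero]
  | neg φ _ h1 =>
    have h3 : birk A (⇑(-φ)) m x = - birk A φ m x := Finset.sum_neg_distrib _
    rw [h3, h1, neg_zero]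

/-- Birkhoff sums of an order unit over periodic points grow linearly. -/
theorem IsOrderUnit.exists_le_birk {A : Matrix (Fin N) (Fin N) ℤ} {f : C(Space A, ℤ)}
    (hf : IsOrderUnit A (cohClass A f)) :
    ∃ c : ℕ, 0 < c ∧ ∀ (m : ℕ) (x : Space A), (shift A)^[m] x = x → (m : ℤ) ≤ c * birk A f m x := by
  obtain ⟨c, hc, φ, hφ, heq⟩ := hf.2 (cohClass A 1)
  refine ⟨c, hc, fun m x hx => ?_⟩
  have hmem : -φ + (c • f - 1) ∈ cobdySubgroup A :=
    QuotientAddGroup.eq.1 heq.symm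
  have h0 := birk_eq_zero_of_mem_cobdySubgroup hmem hx
  have h1 : birk A (⇑(-φ + (c • f - 1))) m x = - birk A φ m x + (c * birk A f m x - m) := by
    simp [birk, Finset.sum_add_distrib, Finset.mul_sum]
  have h2 : 0 ≤ birk A φ m x := Finset.sum_nonneg fun i _ => hφ _
  omega

theorem finite_periodic (A : Matrix (Fin N) (Fin N) ℤ) (n : ℕ) :
    Finite {x : Space A // (shift A)^[n + 1] x = x} :=
  ((finite_setOf_iterate_eq_iterate (A := A) (Nat.succ_pos n)).subset
    (fun x (hx : (shift A)^[n + 1] x = x) => hx.symm)).to_subtype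

theorem card_periodic_le (A : Matrix (Fin N) (Fin N) ℤ) (n : ℕ) :
    Nat.card {x : Space A // (shift A)^[n + 1] x = x} ≤ N ^ (n + 1) := by
  have hinj : Function.Injective
      (fun (x : {x : Space A // (shift A)^[n + 1] x = x}) (t : Fin (n + 1)) => x.1.1 t) := by
    intro x y hxy
    apply Subtype.ext
    apply Subtype.ext
    funext i
    have hred : ∀ z : {x : Space A // (shift A)^[n + 1] x = x},
        z.1.1 i = z.1.1 (i % (n + 1)) := by
      intro z
      have h1 := Function.IsPeriodicPt.const_mul
        (show Function.IsPeriodicPt (shift A) (n + 1) z.1 from z.2) (i / (n + 1))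
      have h2 := congrArg (fun w : Space A => w.1 (i % (n + 1))) h1
      simp only [shift_iterate_apply] at h2
      rwa [mul_comm, Nat.mod_add_div] at h2
    rw [hred x, hred y]
    exact congrFun hxy ⟨i % (n + 1), Nat.mod_lt _ (Nat.succ_pos n)⟩
  simpa using Nat.card_le_card_of_injective _ hinj

theorem IsOrderUnit.exists_summable {A : Matrix (Fin N) (Fin N) ℤ} (hN : 0 < N)
    {f : C(Space A, ℤ)} (hf : IsOrderUnit A (cohClass A f)) :
    ∃ h0 : ℝ, ∀ s : ℂ, h0 < s.re → Summable (zetaTerm A f s) := by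
  obtain ⟨c, hc, hle⟩ := hf.exists_le_birk
  have hc0 : (0 : ℝ) < c := by exact_mod_cast hc
  have hN0 : (0 : ℝ) < N := by exact_mod_cast hN
  refine ⟨max 0 (c * Real.log N), fun s hs => ?_⟩
  have hs0 : 0 < s.re := (le_max_left _ _).trans_lt hs
  have hs1 : c * Real.log N < s.re := (le_max_right _ _).trans_lt hs
  set r : ℝ := Real.exp (-s.re / c) with hr
  have hNr : N * r < 1 := by
    have h1 : r < Real.exp (-Real.log N) := by
      apply Real.exp_lt_exp.2
      rw [neg_div, neg_lt_neg_iff, lt_div_iff₀ hc0]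
      linarith
    rw [Real.exp_neg, Real.exp_log hN0] at h1
    calc N * r < N * (N : ℝ)⁻¹ := mul_lt_mul_of_pos_left h1 hN0
      _ = 1 := mul_inv_cancel₀ hN0.ne'
  have hbound : ∀ a : PerPt A, ‖zetaTerm A f s a‖ ≤ r ^ (a.1 + 1) := by
    intro a
    have h1 : ‖(1 / (a.1 + 1 : ℂ))‖ ≤ 1 := by
      have : ‖(a.1 + 1 : ℂ)‖ = a.1 + 1 := by
        exact_mod_cast Complex.norm_natCast (a.1 + 1)
      rw [norm_div, this, norm_one]
      exact div_le_one_of_le₀ (by linarith [Nat.cast_nonneg (α := ℝ) a.1]) (by positivity)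
    have h2 : ((a.1 + 1 : ℕ) : ℝ) ≤ c * (birk A f (a.1 + 1) a.2.1 : ℝ) := by
      exact_mod_cast hle (a.1 + 1) a.2.1 a.2.2
    have h3 : ‖Complex.exp (-s * ((birk A f (a.1 + 1) a.2.1 : ℤ) : ℂ))‖ ≤ r ^ (a.1 + 1) := by
      rw [Complex.norm_exp, hr, ← Real.exp_nat_mul]
      apply Real.exp_le_exp.2
      have h4 : (-s * ((birk A f (a.1 + 1) a.2.1 : ℤ) : ℂ)).re =
          -s.re * (birk A f (a.1 + 1) a.2.1 : ℝ) := by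
        simp
      have h5 : ((a.1 + 1 : ℕ) : ℝ) / c ≤ (birk A f (a.1 + 1) a.2.1 : ℝ) := by
        rw [div_le_iff₀ hc0]
        linarith
      rw [h4, mul_div_assoc', mul_comm _ (-s.re), mul_div_assoc]
      exact mul_le_mul_of_nonpos_left h5 (by linarith)
    rw [zetaTerm, norm_mul]
    calc _ ≤ 1 * r ^ (a.1 + 1) := mul_le_mul h1 h3 (norm_nonneg _) zero_le_one
      _ = _ := one_mul _
  have hfin := finite_periodic A
  let _ : ∀ n : ℕ, Fintype {x : Space A // (shift A)^[n + 1] x = x} :=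
    fun n => Fintype.ofFinite _
  have hr0 : 0 ≤ r := (Real.exp_pos _).le
  refine Summable.of_norm_bounded (g := fun a : PerPt A => r ^ (a.1 + 1)) ?_ hbound
  rw [summable_sigma_of_nonneg fun a => pow_nonneg hr0 _]
  refine ⟨fun n => (hasSum_fintype _).summable, ?_⟩
  have hgeo : Summable fun n : ℕ => ((N : ℝ) * r) ^ (n + 1) :=
    (summable_nat_add_iff 1).2 (summable_geometric_of_lt_one (by positivity) hNr)
  refine Summable.of_nonneg_of_le (fun n => tsum_nonneg fun _ => pow_nonneg hr0 _)
    (fun n => ?_) hgeo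
  show ∑' _ : {x : Space A // (shift A)^[n + 1] x = x}, r ^ (n + 1) ≤ _
  rw [tsum_fintype, Finset.sum_const, Finset.card_univ, ← Nat.card_eq_fintype_card,
    nsmul_eq_mul, mul_pow]
  exact mul_le_mul_of_nonneg_right (by exact_mod_cast card_periodic_le A n) (pow_nonneg hr0 _)

theorem fe_zeta_equalities
    {N M : ℕ} (A : Matrix (Fin N) (Fin N) ℤ) (B : Matrix (Fin M) (Fin M) ℤ)
    (hN : 1 < N) (hM : 1 < M) (hA01 : IsZeroOne A) (hB01 : IsZeroOne B)
    (hAirr : IsIrreducible A) (hBirr : IsIrreducible B)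
    (hAnp : ¬ IsPermutationMatrix A) (hBnp : ¬ IsPermutationMatrix B)
    (h : Space A ≃ₜ Space B) (hfe : FlowEquivVia A B h)
    (k1 l1 : C(Space A, ℕ)) (k2 l2 : C(Space B, ℕ))
    (horb : OrbitEqFns A B h k1 l1 k2 l2)
    (f : C(Space B, ℤ)) (g : C(Space A, ℤ))
    (hf : IsOrderUnit B (cohClass B f)) (hg : IsOrderUnit A (cohClass A g)) :
    ∃ h0 : ℝ, ∀ s : ℂ, h0 < s.re →
      zeta A (psi A B (⇑h) (⇑l1) (⇑k1) (⇑f)) s = zeta B (⇑f) s ∧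
      zeta B (psi B A (⇑h.symm) (⇑l2) (⇑k2) (⇑g)) s = zeta A (⇑g) s := by
  have D : OrbitData A B h k1 l1 k2 l2 :=
    ⟨horb.1, horb.2, dense_aperiodic hA01 hAirr hAnp, dense_aperiodic hB01 hBirr hBnp,
      nhdsNE_neBot hA01 hAirr hAnp, nhdsNE_neBot hB01 hBirr hBnp⟩
  obtain ⟨hB0, hBs⟩ := hf.exists_summable (by omega)
  obtain ⟨hA0, hAs⟩ := hg.exists_summable (by omega)
  refine ⟨max hA0 hB0, fun s hs => ⟨?_, ?_⟩⟩
  · exact D.zeta_psi f (hBs s ((le_max_right _ _).trans_lt hs))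
  · exact D.symm.zeta_psi g (hAs s ((le_max_left _ _).trans_lt hs))

end OneSidedMarkov
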